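/- Let θ > 1, p > 1, and β ∈ (0, F'(u_−)). Let z_β^− := min{ z ∈ ℝ : G_β'(z) = 0 } (so that G_β''(z_β^−) > 0) and let z_β^+ be the unique point with z_β^+ > z_β^−, G_β(z_β^+) = G_β(z_β^−) and G_β'(z_β^+) < 0. Then the integral ∫_{z_β^−}^{z_β^+} [G_β(s) − G_β(z_β^−)]^{−1/p} ds is finite if and only if p > 2. -/

import Mathlib

open Set MeasureTheory intervalIntegral Filter Topology

noncomputable def F (θ u : ℝ) : ℝ := (1 / (2 * θ)) * |1 - u ^ 2| ^ θ

noncomputable def F' (θ u : ℝ) : ℝ := -u * (1 - u ^ 2) * |1 - u ^ 2| ^ (θ - 2)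

noncomputable def G (θ β u : ℝ) : ℝ := F θ u - β * u

noncomputable def uminus (θ : ℝ) : ℝ := -((2 * θ - 1) ^ (-(1 : ℝ) / 2))

noncomputable def uplus (θ : ℝ) : ℝ := (2 * θ - 1) ^ (-(1 : ℝ) / 2)


lemma edge (h : ℝ → ℝ) (hc : Continuous h) (k : ℕ) (m p L : ℝ) (hp : 0 < p) (hm : 0 < m)
    (hpos : ∀ s, 0 < s → s ≤ m → 0 < h s) (hL : 0 < L)
    (lim : Tendsto (fun x => h x / x ^ k) (𝓝[>] 0) (𝓝 L)) :
    IntervalIntegrable (fun x => (h x) ^ (-(1:ℝ) / p)) volume 0 m ↔ (k : ℝ) < p := by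
  have hmeas : Measurable (fun x => (h x) ^ (-(1:ℝ) / p)) := hc.measurable.pow_const _
  have hmeas2 : Measurable (fun x : ℝ => x ^ (-(k:ℝ) / p)) := measurable_id.pow_const _
  have hT : (fun x : ℝ => x ^ (-(k:ℝ) / p)) =Θ[𝓝[>] 0] (fun x => (h x) ^ (-(1:ℝ) / p)) := by
    apply Asymptotics.isTheta_of_div_tendsto_nhds_ne_zero (c := L ^ (-(1:ℝ)/p))
    · have := lim.rpow_const (p := -(1:ℝ)/p) (Or.inl hL.ne')
      refine this.congr' ?_
      filter_upwards [Ioo_mem_nhdsGT hm] with x hx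
      rw [Real.div_rpow (hpos x hx.1 hx.2.le).le (pow_nonneg hx.1.le _), ← Real.rpow_natCast,
        ← Real.rpow_mul hx.1.le]
      congr 2
      ring
    · exact (Real.rpow_pos_of_pos hL _).ne'
  have key : (k:ℝ) < p ↔ -1 < -(k:ℝ)/p := by
    rw [lt_div_iff₀ hp]
    constructor <;> intro h <;> linarith
  rw [key]
  constructor
  · intro hi
    rw [intervalIntegrable_iff_integrableOn_Ioo_of_le hm.le] at hi
    have h1 : IntegrableAtFilter (fun x => (h x) ^ (-(1:ℝ) / p)) (𝓝[>] 0) :=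
      ⟨_, Ioo_mem_nhdsGT hm, hi⟩
    obtain ⟨s, hs, hs2⟩ := hT.1.integrableAtFilter
      (hmeas2.stronglyMeasurable.stronglyMeasurableAtFilter) h1
    obtain ⟨d, hd, hd2⟩ := mem_nhdsGT_iff_exists_Ioo_subset.1 hs
    exact (intervalIntegral.integrableOn_Ioo_rpow_iff hd).1 (hs2.mono_set hd2)
  · intro hi
    have h1 : IntegrableAtFilter (fun x : ℝ => x ^ (-(k:ℝ) / p)) (𝓝[>] 0) :=
      ⟨_, Ioo_mem_nhdsGT hm, (intervalIntegral.integrableOn_Ioo_rpow_iff hm).2 hi⟩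
    obtain ⟨s, hs, hs2⟩ := hT.2.integrableAtFilter
      (hmeas.stronglyMeasurable.stronglyMeasurableAtFilter) h1
    obtain ⟨d, hd, hd2⟩ := mem_nhdsGT_iff_exists_Ioo_subset.1 hs
    have hd : 0 < d := hd
    set e := min d m
    have he : 0 < e := lt_min hd hm
    have h2 : IntervalIntegrable (fun x => (h x) ^ (-(1:ℝ) / p)) volume 0 e := by
      rw [intervalIntegrable_iff_integrableOn_Ioo_of_le he.le]
      exact hs2.mono_set ((Ioo_subset_Ioo_right (min_le_left _ _)).trans hd2)
    refine h2.trans (ContinuousOn.intervalIntegrable ?_)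
    rw [uIcc_of_le (min_le_right _ _)]
    exact hc.continuousOn.rpow_const (fun x hx => Or.inl (hpos x (he.trans_le hx.1) hx.2).ne')

lemma G_deriv (θ β u : ℝ) (hθ : 1 < θ) : HasDerivAt (G θ β) (F' θ u - β) u := by
  have h1 : HasDerivAt (fun u : ℝ => 1 - u ^ 2) (-(2 * u)) u := by
    simpa using (hasDerivAt_pow 2 u).const_sub 1
  have h2 := ((hasDerivAt_abs_rpow (1 - u ^ 2) hθ).comp u h1).const_mul (1 / (2 * θ))
  have h3 := h2.sub ((hasDerivAt_id u).const_mul β)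
  refine (h3.congr_deriv ?_)
  unfold F'
  field_simp

lemma F'_eq (θ u : ℝ) (hu : 0 < 1 - u ^ 2) : F' θ u = -u * (1 - u ^ 2) ^ (θ - 1) := by
  unfold F'
  rw [abs_of_pos hu, show θ - 1 = 1 + (θ - 2) by ring, Real.rpow_add hu, Real.rpow_one]
  ring

lemma F'_deriv (θ u : ℝ) (hu : 0 < 1 - u ^ 2) :
    HasDerivAt (F' θ) ((1 - u ^ 2) ^ (θ - 2) * ((2 * θ - 1) * u ^ 2 - 1)) u := by
  have h1 : HasDerivAt (fun u : ℝ => 1 - u ^ 2) (-(2 * u)) u := by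
    simpa using (hasDerivAt_pow 2 u).const_sub 1
  have h2 := (hasDerivAt_id u).neg.mul (h1.rpow_const (p := θ - 1) (Or.inl hu.ne'))
  have h3 : F' θ =ᶠ[𝓝 u] fun u => -u * (1 - u ^ 2) ^ (θ - 1) := by
    have : ∀ᶠ x in 𝓝 u, 0 < 1 - x ^ 2 :=
      (by fun_prop : Continuous fun x : ℝ => 1 - x ^ 2).continuousAt.eventually (lt_mem_nhds hu)
    filter_upwards [this] with x hx using F'_eq θ x hx
  refine HasDerivAt.congr_of_eventuallyEq ?_ h3
  refine h2.congr_deriv ?_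
  simp only [Pi.neg_apply, id]
  rw [show θ - 1 - 1 = θ - 2 by ring, show θ - 1 = 1 + (θ - 2) by ring, Real.rpow_add hu,
    Real.rpow_one]
  ring

lemma lim2 (g g' : ℝ → ℝ) (a A : ℝ) (hg : ∀ x, HasDerivAt g (g' x) x) (h0 : g' a = 0)
    (h' : HasDerivAt g' A a) :
    Tendsto (fun x => (g (a + x) - g a) / x ^ 2) (𝓝[>] 0) (𝓝 (A / 2)) := by
  apply HasDerivAt.lhopital_zero_nhdsGT (f' := fun x => g' (a + x)) (g' := fun x => 2 * x)
  · refine Eventually.of_forall fun x => ?_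
    simpa using ((hg (a + x)).comp_const_add a x).sub_const (g a)
  · refine Eventually.of_forall fun x => ?_
    simpa using hasDerivAt_pow 2 x
  · filter_upwards [self_mem_nhdsWithin] with x hx
    have : (0:ℝ) < x := hx
    positivity
  · have hc : Continuous g := continuous_iff_continuousAt.2 fun x => (hg x).continuousAt
    have : Continuous (fun x => g (a + x) - g a) := by fun_prop
    simpa using (this.tendsto 0).mono_left nhdsWithin_le_nhds
  · have : Continuous (fun x : ℝ => x ^ 2) := by fun_prop
    simpa using (this.tendsto 0).mono_left nhdsWithin_le_nhds
  · have := (hasDerivAt_iff_tendsto_slope_zero.1 h').mono_left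
      (nhdsWithin_mono 0 (fun x (hx : 0 < x) => hx.ne'))
    refine (this.div_const 2).congr fun x => ?_
    rw [h0, smul_eq_mul]
    simp only [sub_zero]
    ring

lemma lim1 (g : ℝ → ℝ) (a A : ℝ) (hg : HasDerivAt g A a) :
    Tendsto (fun x => (g (a - x) - g a) / x ^ 1) (𝓝[>] 0) (𝓝 (-A)) := by
  have h1 : HasDerivAt (fun x => g (a - x)) (-A) 0 := by
    have : HasDerivAt g A (a - 0) := by simpa using hg
    simpa using this.comp_const_sub a 0
  have := (hasDerivAt_iff_tendsto_slope_zero.1 h1).mono_left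
      (nhdsWithin_mono 0 (fun x (hx : 0 < x) => hx.ne'))
  refine this.congr fun x => ?_
  simp
  ring

lemma F'_eq' (θ u : ℝ) (hθ : 1 < θ) (hu : 0 ≤ 1 - u ^ 2) :
    F' θ u = -u * (1 - u ^ 2) ^ (θ - 1) := by
  rcases hu.eq_or_lt with h | h
  · unfold F'
    rw [← h, Real.zero_rpow (by linarith : θ - 1 ≠ 0)]
    simp
  · exact F'_eq θ u h

lemma F'_eq_ge (θ u : ℝ) (hθ : 1 < θ) (hu : 1 ≤ u) :
    F' θ u = u * (u ^ 2 - 1) ^ (θ - 1) := by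
  have hu' : 0 ≤ u ^ 2 - 1 := by nlinarith
  unfold F'
  rcases hu'.eq_or_lt with h | h
  · rw [show 1 - u ^ 2 = 0 by linarith, ← h, Real.zero_rpow (by linarith : θ - 1 ≠ 0)]
    simp
  · rw [abs_sub_comm, abs_of_pos h, show θ - 1 = 1 + (θ - 2) by ring, Real.rpow_add h,
      Real.rpow_one]
    ring

lemma F'_mono_ge (θ u v : ℝ) (hθ : 1 < θ) (hu : 1 ≤ u) (huv : u ≤ v) : F' θ u ≤ F' θ v := by
  rw [F'_eq_ge θ u hθ hu, F'_eq_ge θ v hθ (hu.trans huv)]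
  have h1 : 0 ≤ u ^ 2 - 1 := by nlinarith
  have h2 : u ^ 2 - 1 ≤ v ^ 2 - 1 := by nlinarith
  have h3 := Real.rpow_le_rpow h1 h2 (by linarith : 0 ≤ θ - 1)
  exact mul_le_mul huv h3 (Real.rpow_nonneg h1 _) (by linarith)

lemma F'_nonpos_mid (θ u : ℝ) (h0 : 0 ≤ u) (h1 : u ≤ 1) : F' θ u ≤ 0 := by
  unfold F'
  have := Real.rpow_nonneg (abs_nonneg (1 - u ^ 2)) (θ - 2)
  have h2 : 0 ≤ u * (1 - u ^ 2) := mul_nonneg h0 (by nlinarith)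
  nlinarith [mul_nonneg h2 this]

lemma F'_nonpos_left (θ u : ℝ) (h1 : u ≤ -1) : F' θ u ≤ 0 := by
  unfold F'
  have := Real.rpow_nonneg (abs_nonneg (1 - u ^ 2)) (θ - 2)
  have h2 : 0 ≤ u * (1 - u ^ 2) := mul_nonneg_of_nonpos_of_nonpos (by linarith) (by nlinarith)
  nlinarith [mul_nonneg h2 this]

lemma w_props (θ : ℝ) (hθ : 1 < θ) :
    -1 < uminus θ ∧ uminus θ < 0 ∧ (2 * θ - 1) * uminus θ ^ 2 = 1 := by
  have h : 0 < 2 * θ - 1 := by linarith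
  have hsq : (2 * θ - 1) * uminus θ ^ 2 = 1 := by
    unfold uminus
    rw [neg_sq, ← Real.rpow_natCast, ← Real.rpow_mul h.le]
    norm_num
    rw [Real.rpow_neg_one]
    field_simp
  have hneg : uminus θ < 0 := by
    unfold uminus
    have := Real.rpow_pos_of_pos h (-(1:ℝ)/2)
    linarith
  refine ⟨?_, hneg, hsq⟩
  by_contra hh
  push Not at hh
  have h1 : 1 ≤ uminus θ ^ 2 := by nlinarith
  nlinarith

lemma F'_strictMono (θ : ℝ) (hθ : 1 < θ) : StrictMonoOn (F' θ) (Ioc (-1) (uminus θ)) := by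
  obtain ⟨h1, h2, h3⟩ := w_props θ hθ
  have hd : ∀ u ∈ Ioc (-1) (uminus θ), 0 < 1 - u ^ 2 := fun u hu => by nlinarith [hu.1, hu.2]
  apply strictMonoOn_of_deriv_pos (convex_Ioc _ _)
  · exact fun u hu => (F'_deriv θ u (hd u hu)).continuousAt.continuousWithinAt
  · intro u hu
    rw [interior_Ioc] at hu
    rw [(F'_deriv θ u (hd u ⟨hu.1, hu.2.le⟩)).deriv]
    have : uminus θ ^ 2 < u ^ 2 := by nlinarith [hu.2]
    exact mul_pos (Real.rpow_pos_of_pos (hd u ⟨hu.1, hu.2.le⟩) _) (by nlinarith)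

lemma F'_strictAnti (θ : ℝ) (hθ : 1 < θ) : StrictAntiOn (F' θ) (Icc (uminus θ) 0) := by
  obtain ⟨h1, h2, h3⟩ := w_props θ hθ
  have hd : ∀ u ∈ Icc (uminus θ) 0, 0 < 1 - u ^ 2 := fun u hu => by nlinarith [hu.1, hu.2]
  apply strictAntiOn_of_deriv_neg (convex_Icc _ _)
  · exact fun u hu => (F'_deriv θ u (hd u hu)).continuousAt.continuousWithinAt
  · intro u hu
    rw [interior_Icc] at hu
    have hu' : u ∈ Icc (uminus θ) 0 := ⟨hu.1.le, hu.2.le⟩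
    rw [(F'_deriv θ u (hd u hu')).deriv]
    have : u ^ 2 < uminus θ ^ 2 := by nlinarith [hu.1, hu.2]
    exact mul_neg_of_pos_of_neg (Real.rpow_pos_of_pos (hd u hu') _) (by nlinarith)

lemma zm_props (θ β zm : ℝ) (hθ : 1 < θ) (hβ : β ∈ Set.Ioo (0 : ℝ) (F' θ (uminus θ)))
    (hzm : IsLeast {z : ℝ | F' θ z - β = 0} zm) : -1 < zm ∧ zm < uminus θ := by
  obtain ⟨h1, h2, h3⟩ := w_props θ hθ
  have h0 : F' θ zm - β = 0 := hzm.1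
  constructor
  · by_contra h
    push Not at h
    linarith [F'_nonpos_left θ zm h, hβ.1]
  · have hd : ∀ u ∈ Icc (-1) (uminus θ), 0 ≤ 1 - u ^ 2 := fun u hu => by nlinarith [hu.1, hu.2]
    have hc : ContinuousOn (F' θ) (Icc (-1) (uminus θ)) := by
      refine ContinuousOn.congr (f := fun u => -u * (1 - u ^ 2) ^ (θ - 1)) ?_
        (fun u hu => F'_eq' θ u hθ (hd u hu))
      refine continuousOn_id.neg.mul (ContinuousOn.rpow_const (by fun_prop) ?_)
      intro x _
      right
      linarith
    have hm := intermediate_value_Ioo h1.le hc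
    obtain ⟨z, hz, hz2⟩ := hm ⟨(F'_nonpos_left θ (-1) le_rfl).trans_lt hβ.1, hβ.2⟩
    exact (hzm.2 (show F' θ z - β = 0 by rw [hz2]; ring)).trans_lt hz.2

lemma G_cont (θ β : ℝ) (hθ : 1 < θ) : Continuous (G θ β) :=
  continuous_iff_continuousAt.2 fun x => (G_deriv θ β x hθ).continuousAt

lemma G_lt (θ β a b : ℝ) (hθ : 1 < θ) (hab : a < b) (h : ∀ x ∈ Ioo a b, β < F' θ x) :
    G θ β a < G θ β b := by
  refine strictMonoOn_of_deriv_pos (convex_Icc a b) (G_cont θ β hθ).continuousOn ?_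
    ⟨le_rfl, hab.le⟩ ⟨hab.le, le_rfl⟩ hab
  intro x hx
  rw [interior_Icc] at hx
  rw [(G_deriv θ β x hθ).deriv]
  linarith [h x hx]

lemma G_gt (θ β a b : ℝ) (hθ : 1 < θ) (hab : a < b) (h : ∀ x ∈ Ioo a b, F' θ x < β) :
    G θ β b < G θ β a := by
  refine strictAntiOn_of_deriv_neg (convex_Icc a b) (G_cont θ β hθ).continuousOn ?_
    ⟨le_rfl, hab.le⟩ ⟨hab.le, le_rfl⟩ hab
  intro x hx
  rw [interior_Icc] at hx
  rw [(G_deriv θ β x hθ).deriv]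
  linarith [h x hx]

lemma G_pos (θ β zm zp : ℝ) (hθ : 1 < θ)
    (hβ : β ∈ Set.Ioo (0 : ℝ) (F' θ (uminus θ)))
    (hzm : IsLeast {z : ℝ | F' θ z - β = 0} zm)
    (hzp : zm < zp ∧ G θ β zp = G θ β zm ∧ F' θ zp - β < 0) (s : ℝ) (hs : s ∈ Ioo zm zp) :
    G θ β zm < G θ β s := by
  obtain ⟨h1, h2, h3⟩ := w_props θ hθ
  obtain ⟨h4, h5⟩ := zm_props θ β zm hθ hβ hzm
  have h0 : F' θ zm - β = 0 := hzm.1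
  obtain ⟨h6, h7, h8⟩ := hzp
  have hinc : ∀ x, zm < x → x ≤ uminus θ → β < F' θ x := fun x hx hx' => by
    have := F'_strictMono θ hθ ⟨h4, h5.le⟩ ⟨h4.trans hx, hx'⟩ hx
    linarith
  by_cases hF : β < F' θ s
  · apply G_lt θ β zm s hθ hs.1
    intro x hx
    rcases le_total x (uminus θ) with hxw | hxw
    · exact hinc x hx.1 hxw
    · have hs0 : s ≤ 0 := by
        by_contra hs0
        push Not at hs0
        rcases le_total s 1 with hs1 | hs1
        · linarith [F'_nonpos_mid θ s hs0.le hs1, hβ.1]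
        · linarith [F'_mono_ge θ s zp hθ hs1 hs.2.le]
      exact hF.trans (F'_strictAnti θ hθ ⟨hxw, hx.2.le.trans hs0⟩ ⟨hxw.trans hx.2.le, hs0⟩ hx.2)
  · rw [← h7]
    apply G_gt θ β s zp hθ hs.2
    intro x hx
    push Not at hF
    have hsw : uminus θ < s := by
      by_contra hh
      push Not at hh
      linarith [hinc s hs.1 hh]
    rcases le_total x 0 with hx0 | hx0
    · exact (F'_strictAnti θ hθ ⟨hsw.le, hx.1.le.trans hx0⟩ ⟨hsw.le.trans hx.1.le, hx0⟩
        hx.1).trans_le hF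
    · rcases le_total x 1 with hx1 | hx1
      · linarith [F'_nonpos_mid θ x hx0 hx1, hβ.1]
      · linarith [F'_mono_ge θ x zp hθ hx1 hx.2.le]

theorem stmt4 (p θ β zm zp : ℝ) (hθ : 1 < θ) (hp : 1 < p)
    (hβ : β ∈ Set.Ioo (0 : ℝ) (F' θ (uminus θ)))
    (hzm : IsLeast {z : ℝ | F' θ z - β = 0} zm)
    (hzp : zm < zp ∧ G θ β zp = G θ β zm ∧ F' θ zp - β < 0)
    (hzpu : ∀ z, zm < z → G θ β z = G θ β zm → F' θ z - β < 0 → z = zp) :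
    MeasureTheory.IntegrableOn (fun s => (G θ β s - G θ β zm) ^ (-(1 : ℝ) / p))
      (Set.Ioo zm zp) ↔ 2 < p := by
  have hpos := G_pos θ β zm zp hθ hβ hzm hzp
  obtain ⟨h1, h2, h3⟩ := w_props θ hθ
  obtain ⟨h4, h5⟩ := zm_props θ β zm hθ hβ hzm
  have h0 : F' θ zm - β = 0 := hzm.1
  obtain ⟨h6, h7, h8⟩ := hzp
  have hd : 0 < 1 - zm ^ 2 := by nlinarith
  have hcont := G_cont θ β hθ
  set A := (1 - zm ^ 2) ^ (θ - 2) * ((2 * θ - 1) * zm ^ 2 - 1) with hA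
  have hApos : 0 < A := by
    have : uminus θ ^ 2 < zm ^ 2 := by nlinarith
    exact mul_pos (Real.rpow_pos_of_pos hd _) (by nlinarith)
  have L2 := lim2 (G θ β) (fun u => F' θ u - β) zm A (fun x => G_deriv θ β x hθ) h0
    ((F'_deriv θ zm hd).sub_const β)
  have L1 := lim1 (G θ β) zp _ (G_deriv θ β zp hθ)
  obtain ⟨m, hm1, hm2⟩ := exists_between h6
  have E1 := edge (fun x => G θ β (zm + x) - G θ β zm) (by fun_prop) 2 (m - zm) p (A / 2)
    (by linarith) (by linarith)
    (fun s hs hs' => sub_pos.2 (hpos _ ⟨by linarith, by linarith⟩)) (by linarith) L2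
  have E2 := edge (fun x => G θ β (zp - x) - G θ β zp) (by fun_prop) 1 (zp - m) p _
    (by linarith) (by linarith)
    (fun s hs hs' => sub_pos.2 (h7 ▸ hpos _ ⟨by linarith, by linarith⟩)) (by linarith) L1
  rw [h7] at E2
  have E1' := IntervalIntegrable.comp_add_left_iff
    (f := fun s => (G θ β s - G θ β zm) ^ (-(1 : ℝ) / p)) (a := zm) (b := m) (c := zm)
  have E2' := IntervalIntegrable.comp_sub_left_iff
    (f := fun s => (G θ β s - G θ β zm) ^ (-(1 : ℝ) / p)) (a := zp) (b := m) zp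
  rw [sub_self] at E1' E2'
  rw [E1'] at E1
  rw [E2'] at E2
  rw [← intervalIntegrable_iff_integrableOn_Ioo_of_le h6.le]
  have E3 := E2.2 (by simpa using hp)
  push_cast at E1
  rw [← E1]
  constructor
  · intro h
    refine h.mono_set ?_
    rw [uIcc_of_le hm1.le, uIcc_of_le h6.le]
    exact Icc_subset_Icc_right hm2.le
  · intro h
    exact h.trans E3.symm
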